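/- arXiv:math/0303207 — 3 statements merged into one kernel-verified Lean document; each statement's English description precedes it below -/
import Mathlib

section
/- Let G = (X, σ₀, σ₁) be a connected ribbon graph, and set V := the number of orbits of σ₀, E := |X|/2 (the number of orbits of σ₁), and F := the number of orbits of σ∞ = σ₀⁻¹ ∘ σ₁. Then the integer V − E + F is even and satisfies V − E + F ≤ 2. (Hence the genus g of G, defined by V − E + F = 2 − 2g, is a nonnegative integer; it is the genus of the closed oriented surface obtained by gluing half-infinite strips along G.) -/
/-- The setoid on `X` whose equivalence classes are the orbits (cycles) of a
permutation `σ`. -/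
def sameCycleSetoid {X : Type*} (σ : Equiv.Perm X) : Setoid X :=
  ⟨σ.SameCycle, Equiv.Perm.SameCycle.equivalence σ⟩

/-- The number of orbits of a permutation `σ` of `X`. -/
noncomputable def numOrbits {X : Type*} (σ : Equiv.Perm X) : ℕ :=
  Nat.card (Quotient (sameCycleSetoid σ))

open Equiv.Perm in
/-- A permutation has as many orbits as it has nontrivial cycles and fixed points together. -/
theorem numOrbits_add_sum_cycleType {X : Type*} [Fintype X] [DecidableEq X]
    (σ : Equiv.Perm X) :
    numOrbits σ + σ.cycleType.sum = Fintype.card X + Multiset.card σ.cycleType := by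
  have key : numOrbits σ =
      Multiset.card σ.cycleType + Fintype.card (Function.fixedPoints σ) := by
    have hcard : Multiset.card σ.cycleType = Fintype.card σ.cycleFactorsFinset := by
      simp [cycleType_def]
    rw [hcard, ← Fintype.card_sum, ← Nat.card_eq_fintype_card]
    let F : X → σ.cycleFactorsFinset ⊕ Function.fixedPoints σ := fun x =>
      if h : σ x = x then Sum.inr ⟨x, h⟩
      else Sum.inl ⟨σ.cycleOf x, cycleOf_mem_cycleFactorsFinset_iff.2 (mem_support.2 h)⟩
    have hF : ∀ x y, F x = F y ↔ σ.SameCycle x y := by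
      intro x y
      by_cases hx : σ x = x <;> by_cases hy : σ y = y
      · simp only [F, dif_pos hx, dif_pos hy, Sum.inr.injEq]
        exact ⟨fun h => (show x = y from congrArg Subtype.val h) ▸ SameCycle.rfl,
          fun h => Subtype.ext (h.eq_of_left hx)⟩
      · simp only [F, dif_pos hx, dif_neg hy, reduceCtorEq, false_iff]
        exact fun h => hy (h.apply_eq_self_iff.1 hx)
      · simp only [F, dif_neg hx, dif_pos hy, reduceCtorEq, false_iff]
        exact fun h => hx (h.apply_eq_self_iff.2 hy)
      · simp only [F, dif_neg hx, dif_neg hy, Sum.inl.injEq, Subtype.mk.injEq]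
        exact (sameCycle_iff_cycleOf_eq_of_mem_support (mem_support.2 hx)
          (mem_support.2 hy)).symm
    have hsurj : Function.Surjective F := by
      rintro (⟨c, hc⟩ | ⟨x, hx⟩)
      · obtain ⟨x, hx⟩ := (mem_cycleFactorsFinset_iff.1 hc).1.nonempty_support
        have hcx : c = σ.cycleOf x := cycle_is_cycleOf hx hc
        have hσx : σ x ≠ x :=
          mem_support.1 (mem_cycleFactorsFinset_support_le hc hx)
        exact ⟨x, by simp only [F, dif_neg hσx, hcx]⟩
      · exact ⟨x, dif_pos hx⟩
    refine Nat.card_congr (Equiv.ofBijective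
      (Quotient.lift (s := sameCycleSetoid σ) F fun x y => (hF x y).2) ⟨?_, ?_⟩)
    · rintro ⟨x⟩ ⟨y⟩ h
      exact Quotient.sound ((hF x y).1 h)
    · intro z
      obtain ⟨x, rfl⟩ := hsurj z
      exact ⟨Quotient.mk _ x, rfl⟩
  have := card_fixedPoints σ
  have := sum_cycleType_le σ
  omega

theorem sign_eq_neg_one_pow_card_add_numOrbits {X : Type*} [Fintype X] [DecidableEq X]
    (σ : Equiv.Perm X) :
    Equiv.Perm.sign σ = (-1) ^ (Fintype.card X + numOrbits σ) := by
  have h := numOrbits_add_sum_cycleType σ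
  rw [Equiv.Perm.sign_of_cycleType]
  refine neg_one_pow_congr ?_
  grind

/-- A fixed-point-free involution has two elements in each orbit. -/
theorem two_mul_numOrbits_of_involution {X : Type*} [Fintype X] (σ : Equiv.Perm X)
    (hinv : σ * σ = 1) (hfpf : ∀ x, σ x ≠ x) : 2 * numOrbits σ = Fintype.card X := by
  classical
  have : Fact (Nat.Prime 2) := ⟨Nat.prime_two⟩
  have h := numOrbits_add_sum_cycleType σ
  have hs : σ.cycleType.sum = Fintype.card X := by
    rw [Equiv.Perm.sum_cycleType, ← Finset.card_univ]
    congr 1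
    ext x
    simp [hfpf x]
  have hc := congrArg Multiset.sum
    (Equiv.Perm.cycleType_of_pow_prime_eq_one (p := 2) (by rw [pow_two, hinv]))
  rw [Multiset.sum_replicate, smul_eq_mul] at hc
  omega

theorem eq_comp_of_mem_closure {X Y : Type*} {S : Set (Equiv.Perm X)} {f : X → Y}
    (hf : ∀ g ∈ S, ∀ x, f (g x) = f x) {g : Equiv.Perm X} (hg : g ∈ Subgroup.closure S) :
    ∀ x, f (g x) = f x := by
  induction hg using Subgroup.closure_induction with
  | mem g hg => exact hf g hg
  | one => exact fun _ => rfl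
  | mul g h _ _ hg hh => exact fun x => (hg (h x)).trans (hh x)
  | inv g _ hg => exact fun x => by simpa using (hg (g⁻¹ x)).symm

/-- The operator `f ↦ f ∘ σ - f` on rational functions on `X`. -/
def coboundary {X : Type*} (σ : Equiv.Perm X) : (X → ℚ) →ₗ[ℚ] (X → ℚ) :=
  LinearMap.funLeft ℚ ℚ σ - LinearMap.id

@[simp]
theorem coboundary_apply {X : Type*} (σ : Equiv.Perm X) (f : X → ℚ) (x : X) :
    coboundary σ f x = f (σ x) - f x := rfl

theorem mem_ker_coboundary {X : Type*} {σ : Equiv.Perm X} {f : X → ℚ} :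
    f ∈ LinearMap.ker (coboundary σ) ↔ ∀ x, f (σ x) = f x := by
  simp [LinearMap.mem_ker, funext_iff, sub_eq_zero]

/-- The kernel of `coboundary σ` consists of the functions on the orbits of `σ`. -/
theorem finrank_ker_coboundary {X : Type*} [Fintype X] (σ : Equiv.Perm X) :
    Module.finrank ℚ (LinearMap.ker (coboundary σ)) = numOrbits σ := by
  classical
  let π : X → Quotient (sameCycleSetoid σ) := Quotient.mk _
  have hinj : Function.Injective (LinearMap.funLeft ℚ ℚ π) :=
    LinearMap.funLeft_injective_of_surjective ℚ ℚ π Quotient.mk_surjective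
  have hrange : LinearMap.ker (coboundary σ) = LinearMap.range (LinearMap.funLeft ℚ ℚ π) := by
    ext f
    rw [mem_ker_coboundary, LinearMap.mem_range]
    constructor
    · intro hf
      refine ⟨Quotient.lift f ?_, rfl⟩
      rintro x _ ⟨i, rfl⟩
      have hi : σ ^ i ∈ Subgroup.closure {σ} :=
        Subgroup.zpow_mem _ (Subgroup.subset_closure (Set.mem_singleton σ)) i
      exact (eq_comp_of_mem_closure (f := f) (by simpa using hf) hi x).symm
    · rintro ⟨f, rfl⟩ x
      exact congrArg f (Quotient.sound (Equiv.Perm.sameCycle_apply_left.2 .rfl))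
  rw [hrange, LinearMap.finrank_range_of_inj hinj, Module.finrank_fintype_fun_eq_card,
    numOrbits, Nat.card_eq_fintype_card]

theorem finrank_range_coboundary {X : Type*} [Fintype X] (σ : Equiv.Perm X) :
    Module.finrank ℚ (LinearMap.range (coboundary σ)) + numOrbits σ = Fintype.card X := by
  rw [← finrank_ker_coboundary, LinearMap.finrank_range_add_finrank_ker,
    Module.finrank_fintype_fun_eq_card]

/-- For a transitive group generated by `S`, any subspace containing the images of the
coboundaries of the generators has codimension at most one. -/
theorem card_le_finrank_add_one {X : Type*} [Fintype X] [Nonempty X]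
    {S : Set (Equiv.Perm X)} (hconn : ∀ x y : X, ∃ g ∈ Subgroup.closure S, g x = y)
    (W : Submodule ℚ (X → ℚ)) (hW : ∀ σ ∈ S, LinearMap.range (coboundary σ) ≤ W) :
    Fintype.card X ≤ Module.finrank ℚ W + 1 := by
  classical
  obtain ⟨x₀⟩ := ‹Nonempty X›
  let e : X → X → ℚ := fun x => Pi.single x 1
  have he : ∀ σ ∈ S, ∀ x, W.mkQ (e (σ x)) = W.mkQ (e x) := by
    intro σ hσ x
    refine ((Submodule.Quotient.eq W).2 (hW σ hσ ⟨e (σ x), ?_⟩)).symm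
    ext y
    simp [e, Pi.single_apply]
  have htop : W ⊔ Submodule.span ℚ {e x₀} = ⊤ := by
    rw [eq_top_iff, ← (Pi.basisFun ℚ X).span_eq, Submodule.span_le]
    rintro _ ⟨x, rfl⟩
    obtain ⟨g, hg, rfl⟩ := hconn x₀ x
    have h := eq_comp_of_mem_closure (f := fun x => W.mkQ (e x)) he hg x₀
    have h' : e (g x₀) - e x₀ ∈ W := (Submodule.Quotient.eq W).1 h
    rw [Pi.basisFun_apply]
    exact Submodule.mem_sup.2 ⟨_, h', _, Submodule.mem_span_singleton_self _,
      sub_add_cancel _ _⟩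
  have h1 := Submodule.finrank_add_le_finrank_add_finrank W (Submodule.span ℚ {e x₀})
  have h2 := finrank_span_le_card (R := ℚ) ({e x₀} : Set (X → ℚ))
  rw [htop, finrank_top, Module.finrank_fintype_fun_eq_card] at h1
  simp only [Set.toFinset_singleton, Finset.card_singleton] at h2
  omega

/-- For a transitive group generated by `S`, a linear map whose kernel consists of
`S`-invariant functions has rank at least `|X| - 1`. -/
theorem card_le_finrank_range_add_one {X M : Type*} [Fintype X] [Nonempty X]
    [AddCommGroup M] [Module ℚ M]
    {S : Set (Equiv.Perm X)} (hconn : ∀ x y : X, ∃ g ∈ Subgroup.closure S, g x = y)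
    (φ : (X → ℚ) →ₗ[ℚ] M) (hφ : ∀ σ ∈ S, LinearMap.ker φ ≤ LinearMap.ker (coboundary σ)) :
    Fintype.card X ≤ Module.finrank ℚ (LinearMap.range φ) + 1 := by
  obtain ⟨x₀⟩ := ‹Nonempty X›
  have hle : LinearMap.ker φ ≤ Submodule.span ℚ {1} := by
    intro f hf
    refine Submodule.mem_span_singleton.2 ⟨f x₀, ?_⟩
    ext x
    obtain ⟨g, hg, rfl⟩ := hconn x₀ x
    simpa using
      (eq_comp_of_mem_closure (fun σ hσ => mem_ker_coboundary.1 (hφ σ hσ hf)) hg x₀).symm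
  have h1 := Submodule.finrank_mono hle
  have h2 := finrank_span_le_card (R := ℚ) ({1} : Set (X → ℚ))
  have h3 := LinearMap.finrank_range_add_finrank_ker φ
  rw [Module.finrank_fintype_fun_eq_card] at h3
  simp only [Set.toFinset_singleton, Finset.card_singleton] at h2
  omega

/-- Ree's inequality for two permutations generating a transitive group. -/
theorem numOrbits_add_numOrbits_add_numOrbits_le {X : Type*} [Fintype X] [Nonempty X]
    (p q : Equiv.Perm X)
    (hconn : ∀ x y : X, ∃ g ∈ Subgroup.closure ({p, q} : Set (Equiv.Perm X)), g x = y) :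
    numOrbits p + numOrbits q + numOrbits (p⁻¹ * q) ≤ Fintype.card X + 2 := by
  let r := p⁻¹ * q
  let β := (coboundary p).rangeRestrict.prod
    (((coboundary r).rangeRestrict ∘ₗ LinearMap.funLeft ℚ ℚ p).prod (coboundary q).rangeRestrict)
  let δ := (LinearMap.range (coboundary p)).subtype.coprod
    ((LinearMap.range (coboundary r)).subtype.coprod (-(LinearMap.range (coboundary q)).subtype))
  have hδβ : LinearMap.range β ≤ LinearMap.ker δ := by
    rintro _ ⟨f, rfl⟩
    rw [LinearMap.mem_ker]
    ext x
    simp [β, δ, r, LinearMap.funLeft_apply]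
  have hβ : Fintype.card X ≤ Module.finrank ℚ (LinearMap.range β) + 1 := by
    refine card_le_finrank_range_add_one hconn β ?_
    rintro σ (rfl | rfl) f hf
    · exact congrArg Subtype.val (congrArg Prod.fst (LinearMap.mem_ker.1 hf))
    · exact congrArg Subtype.val (congrArg (fun z => z.2.2) (LinearMap.mem_ker.1 hf))
  have hδ : Fintype.card X ≤ Module.finrank ℚ (LinearMap.range δ) + 1 := by
    refine card_le_finrank_add_one hconn _ ?_
    rintro σ (rfl | rfl) f hf
    · exact ⟨(⟨f, hf⟩, 0, 0), by simp [δ]⟩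
    · exact ⟨(0, 0, -⟨f, hf⟩), by simp [δ]⟩
  have h := LinearMap.finrank_range_add_finrank_ker δ
  have hmono := Submodule.finrank_mono hδβ
  simp only [Module.finrank_prod] at h
  have hp := finrank_range_coboundary p
  have hq := finrank_range_coboundary q
  have hr : _ + numOrbits (p⁻¹ * q) = _ := finrank_range_coboundary r
  omega

/-- **Euler characteristic of a connected ribbon graph.**
Let `G = (X, σ₀, σ₁)` be a connected ribbon graph: `X` is a nonempty finite set,
`σ₀` is a permutation of `X`, `σ₁` is a fixed-point-free involution of `X`, and the
subgroup generated by `σ₀` and `σ₁` acts transitively on `X`.  Set `V` = number of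
orbits of `σ₀` (vertices), `E = |X|/2` (unoriented edges, i.e. orbits of `σ₁`) and
`F` = number of orbits of the hole permutation `σ∞ = σ₀⁻¹ ∘ σ₁` (holes).
Then `V − E + F` is even and `V − E + F ≤ 2`; hence the genus `g` defined by
`V − E + F = 2 − 2g` is a nonnegative integer. -/
theorem ribbon_graph_euler_characteristic {X : Type*} [Fintype X] [Nonempty X]
    (σ₀ σ₁ : Equiv.Perm X) (hinv : σ₁ * σ₁ = 1) (hfpf : ∀ x : X, σ₁ x ≠ x)
    (hconn : ∀ x y : X, ∃ g ∈ Subgroup.closure ({σ₀, σ₁} : Set (Equiv.Perm X)), g x = y) :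
    Even ((numOrbits σ₀ : ℤ) - ((Fintype.card X / 2 : ℕ) : ℤ) + numOrbits (σ₀⁻¹ * σ₁)) ∧
      (numOrbits σ₀ : ℤ) - ((Fintype.card X / 2 : ℕ) : ℤ) + numOrbits (σ₀⁻¹ * σ₁) ≤ 2 := by
  classical
  have hE := two_mul_numOrbits_of_involution σ₁ hinv hfpf
  have hle := numOrbits_add_numOrbits_add_numOrbits_le σ₀ σ₁ hconn
  have hsign : Equiv.Perm.sign (σ₀⁻¹ * σ₁) = Equiv.Perm.sign σ₀ * Equiv.Perm.sign σ₁ := by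
    simp
  simp only [sign_eq_neg_one_pow_card_add_numOrbits, ← pow_add] at hsign
  have hpar : Even (Fintype.card X + numOrbits (σ₀⁻¹ * σ₁)) ↔
      Even (Fintype.card X + numOrbits σ₀ + (Fintype.card X + numOrbits σ₁)) := by
    rw [← neg_one_pow_eq_one_iff_even (R := ℤˣ) (by decide), hsign,
      neg_one_pow_eq_one_iff_even (by decide)]
  simp only [Nat.even_iff, Int.even_iff] at hpar ⊢
  omega
end

section
/- Let σ be a permutation of a finite set X and let W ⊆ Z ⊆ X with W nonempty. Then the first-return map to W of the first-return map of σ to Z equals the first-return map of σ to W: (σ_Z)_W = σ_W as permutations of W. -/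
/-- `τ` is the first-return map of the permutation `σ` to the subset `Z`:
for every `z ∈ Z`, `τ z = σ^k z` where `k ≥ 1` is minimal with `σ^k z ∈ Z`. -/
def IsFirstReturn {X : Type*} (σ : Equiv.Perm X) (Z : Set X) (τ : Equiv.Perm Z) : Prop :=
  ∀ z : Z, ∃ k : ℕ, 1 ≤ k ∧ (σ ^ k) (z : X) = ((τ z : Z) : X) ∧
    ∀ j : ℕ, 1 ≤ j → (σ ^ j) (z : X) ∈ Z → k ≤ j

/-- If `k` is the first return time of `z ∈ Z` to `W ⊆ Z` under `σ`, then `σ^k z` is also the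
point of first return of `z` to `W` under the first-return map of `σ` to `Z`. -/
theorem IsFirstReturn.exists_pow_eq {X : Type*} {σ : Equiv.Perm X} {Z W : Set X} (hWZ : W ⊆ Z)
    {τ : Equiv.Perm Z} (hτ : IsFirstReturn σ Z τ) (k : ℕ) (z : Z) (hk : 1 ≤ k)
    (hkW : (σ ^ k) (z : X) ∈ W) (hmin : ∀ j : ℕ, 1 ≤ j → (σ ^ j) (z : X) ∈ W → k ≤ j) :
    ∃ n : ℕ, 1 ≤ n ∧ (((τ ^ n) z : Z) : X) = (σ ^ k) (z : X) ∧
      ∀ j : ℕ, 1 ≤ j → (((τ ^ j) z : Z) : X) ∈ W → n ≤ j := by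
  induction k using Nat.strong_induction_on generalizing z with
  | _ k ih =>
    obtain ⟨a, ha, haτ, hamin⟩ := hτ z
    rcases (hamin k hk (hWZ hkW)).eq_or_lt with rfl | hlt
    · exact ⟨1, le_rfl, by rw [pow_one, haτ], fun j hj _ => hj⟩
    · have hshift (j : ℕ) : (σ ^ j) ((τ z : Z) : X) = (σ ^ (j + a)) (z : X) := by
        rw [← haτ, pow_add, Equiv.Perm.mul_apply]
      have hka : (σ ^ (k - a)) ((τ z : Z) : X) = (σ ^ k) (z : X) := by
        rw [hshift, Nat.sub_add_cancel hlt.le]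
      obtain ⟨n, -, hnτ, hnmin⟩ := ih (k - a) (by omega) (τ z) (by omega) (hka ▸ hkW)
        fun j hj hjW => by
          have := hmin (j + a) (by omega) (hshift j ▸ hjW)
          omega
      refine ⟨n + 1, by omega, by rw [pow_succ, Equiv.Perm.mul_apply, hnτ, hka], ?_⟩
      rintro (_ | _ | j) hj hjW
      · omega
      · rw [zero_add, pow_one, ← haτ] at hjW
        have := hmin a ha hjW
        omega
      · rw [pow_succ, Equiv.Perm.mul_apply] at hjW
        have := hnmin (j + 1) (by omega) hjW
        omega

/-- **Transitivity of first-return maps.**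
Let `σ` be a permutation of a finite set `X` and let `W ⊆ Z ⊆ X` with `W` nonempty.
If `τZ` is the first-return map of `σ` to `Z`, `τZW` is the first-return map of `τZ`
to `W` (viewed as a subset of `Z`), and `τW` is the first-return map of `σ` to `W`,
then `(σ_Z)_W = σ_W` as permutations of `W` (under the canonical identification of
`{z : Z // ↑z ∈ W}` with `W`). -/
theorem firstReturn_trans {X : Type*} [Fintype X] (σ : Equiv.Perm X) (Z W : Set X)
    (hWZ : W ⊆ Z) (hW : W.Nonempty)
    (τZ : Equiv.Perm Z) (hτZ : IsFirstReturn σ Z τZ)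
    (τZW : Equiv.Perm {z : Z | (z : X) ∈ W})
    (hτZW : IsFirstReturn τZ {z : Z | (z : X) ∈ W} τZW)
    (τW : Equiv.Perm W) (hτW : IsFirstReturn σ W τW) :
    ∀ w : {z : Z | (z : X) ∈ W},
      (((τZW w : {z : Z | (z : X) ∈ W}) : Z) : X) = ((τW ⟨((w : Z) : X), w.2⟩ : W) : X) := by
  intro w
  obtain ⟨k, hk, hkτ, hkmin⟩ := hτW ⟨((w : Z) : X), w.2⟩
  obtain ⟨m, hm, hmτ, hmmin⟩ := hτZW w
  obtain ⟨n, hn, hnτ, hnmin⟩ :=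
    hτZ.exists_pow_eq hWZ k w hk (by rw [hkτ]; exact Subtype.coe_prop _) hkmin
  have hmn : m = n := by
    refine le_antisymm (hmmin n hn ?_) (hnmin m hm ?_)
    · change (((τZ ^ n) w : Z) : X) ∈ W
      rw [hnτ, hkτ]
      exact Subtype.coe_prop _
    · rw [hmτ]
      exact (τZW w).2
  rw [← hmτ, hmn, hnτ, hkτ]
end

section
/- Let X be a finite set, σ₀ a permutation of X, σ₁ a fixed-point-free involution of X, and σ∞ := σ₀⁻¹ ∘ σ₁. Let Z ⊆ X be a nonempty proper subset with σ₁(Z) = Z. Define on Z the subgraph permutations α₀ := the first-return map of σ₀ to Z and α∞ := α₀⁻¹ ∘ (σ₁ restricted to Z); and define on X∖Z the quotient permutations β∞ := the first-return map of σ∞ to X∖Z and β₀ := (σ₁ restricted to X∖Z) ∘ β∞⁻¹. Then there is a bijection between the set of orbits of α∞ on Z that are not orbits of σ∞ (the exceptional holes of the subgraph G_Z) and the set of orbits of β₀ on X∖Z that are not orbits of σ₀ (the exceptional vertices of the quotient graph G/G_Z). -/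
open Equiv Equiv.Perm

/-- `τ z` is the last point of `Z` strictly before `s z` along the `a`-orbit of `s z`. -/
def IsBackwardReturn {X : Type*} (s a : Perm X) (Z : Set X) (τ : Perm Z) : Prop :=
  ∀ z : Z, ∃ k : ℕ, 1 ≤ k ∧ (a ^ k) (τ z : X) = s z ∧
    ∀ j : ℕ, 1 ≤ j → j < k → (a ^ j) (τ z : X) ∉ Z

lemma mul_mul_pow_apply_of_involutive {X : Type*} {s : Perm X} (hs : ∀ x, s (s x) = x)
    (a : Perm X) (n : ℕ) (x : X) : ((s * a * s) ^ n) x = s ((a ^ n) (s x)) := by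
  induction n generalizing x with
  | zero => simp [hs]
  | succ n ih => simp [pow_succ, ih, hs]

namespace IsBackwardReturn

variable {X : Type*} {s a : Perm X} {Z : Set X} {τ : Perm Z}

lemma apply_eq (h : IsBackwardReturn s a Z τ) (z : Z) (hz : (a⁻¹ * s) (z : X) ∈ Z) :
    (τ z : X) = (a⁻¹ * s) (z : X) := by
  obtain ⟨k, hk, hkz, hmin⟩ := h z
  obtain ⟨k, rfl⟩ := Nat.exists_eq_add_of_le' hk
  have h1 : (a ^ k) (τ z : X) = (a⁻¹ * s) (z : X) := by
    rw [mul_apply, ← hkz, pow_succ', mul_apply, Perm.inv_def, symm_apply_apply]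
  rcases Nat.eq_zero_or_pos k with rfl | hpos
  · simpa using h1
  · exact absurd (h1 ▸ hz) (hmin k hpos (Nat.lt_succ_self k))

lemma conj (hs : ∀ x, s (s x) = x) (hZ : ∀ x, x ∈ Z ↔ s x ∈ Z) {t : Perm Z}
    (ht : ∀ z : Z, (t z : X) = s z) (h : IsBackwardReturn s a Z τ) :
    IsBackwardReturn s (s * a * s) Z (t * τ * t) := by
  intro z
  obtain ⟨k, hk, hkz, hmin⟩ := h (t z)
  refine ⟨k, hk, ?_, fun j hj hjk hmem => hmin j hj hjk ?_⟩
  · rw [mul_mul_pow_apply_of_involutive hs, mul_apply, mul_apply, ht, hs, hkz, ht, hs]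
  · rw [mul_mul_pow_apply_of_involutive hs, mul_apply, mul_apply, ht, hs] at hmem
    exact (hZ _).2 hmem

end IsBackwardReturn

/-- On a finite type, any reflexive transitive relation linking each point of `E` to its first return
in `E` under `f` relates all points of `E` in the same cycle. -/
lemma Equiv.Perm.SameCycle.of_first_return {A : Type*} [Finite A] {f : Perm A} {E : Set A}
    {r : A → A → Prop} (hrefl : ∀ x, r x x) (htrans : ∀ x y z, r x y → r y z → r x z)
    (hstep : ∀ x ∈ E, ∀ n : ℕ, (f ^ (n + 1)) x ∈ E →
      (∀ j, 1 ≤ j → j < n + 1 → (f ^ j) x ∉ E) → r x ((f ^ (n + 1)) x))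
    {x y : A} (hxy : f.SameCycle x y) (hx : x ∈ E) (hy : y ∈ E) : r x y := by
  classical
  obtain ⟨n, rfl⟩ : ∃ n : ℕ, (f ^ n) x = y := by
    obtain ⟨n, -, -, h⟩ := hxy.exists_pow_eq''
    exact ⟨n, h⟩
  clear hxy
  induction n using Nat.strong_induction_on generalizing x with
  | _ n ih =>
    rcases Nat.eq_zero_or_pos n with rfl | hn
    · exact hrefl x
    have hex : ∃ k, (f ^ (k + 1)) x ∈ E := ⟨n - 1, by rwa [Nat.sub_add_cancel hn]⟩
    have hkn : Nat.find hex ≤ n - 1 := Nat.find_min' hex (by rwa [Nat.sub_add_cancel hn])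
    have hk := Nat.find_spec hex
    have hmin : ∀ j, 1 ≤ j → j < Nat.find hex + 1 → (f ^ j) x ∉ E := fun j hj hjk hmem =>
      Nat.find_min hex (m := j - 1) (by omega) (by rwa [Nat.sub_add_cancel hj])
    generalize Nat.find hex = k at hkn hk hmin
    have hsplit : (f ^ (n - (k + 1))) ((f ^ (k + 1)) x) = (f ^ n) x := by
      rw [← mul_apply, ← pow_add, Nat.sub_add_cancel (by omega)]
    refine htrans _ _ _ (hstep x hx k hk hmin) ?_
    rw [← hsplit]
    exact ih _ (by omega) hk (by rwa [hsplit])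

section

variable {X : Type*} {s a b : Perm X} {Z W : Set X} {α : Perm Z} {β : Perm W}

/-- A passage of `α` leaving `Z` at `z` and next leaving it at `z'` corresponds to a passage of
`β` from `a⁻¹ (s z')` back to `a⁻¹ (s z)`. -/
lemma sameCycle_of_isBackwardReturn_of_first_exit (hs : ∀ x, s (s x) = x)
    (hZ : ∀ x, x ∈ Z ↔ s x ∈ Z) (hW : ∀ x, x ∈ W ↔ x ∉ Z) (hb : b = s * a⁻¹)
    (hα : IsBackwardReturn s a Z α) (hβ : IsBackwardReturn s b W β)
    (z : Z) (hz : (a⁻¹ * s) (z : X) ∈ W) (n : ℕ)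
    (hz' : (a⁻¹ * s) ((α ^ (n + 1)) z : X) ∈ W)
    (hmin : ∀ j, 1 ≤ j → j < n + 1 → (a⁻¹ * s) ((α ^ j) z : X) ∉ W) :
    β.SameCycle ⟨_, hz⟩ ⟨_, hz'⟩ := by
  have hbφ : b = s * (a⁻¹ * s) * s := by
    ext x; simp [hb, hs]
  have hba : b⁻¹ * s = a := by
    ext x
    rw [mul_apply, inv_eq_iff_eq]; simp [hb]
  -- the `α`-orbit of `α z` follows `a⁻¹ * s` up to the next exit
  have hpow : ∀ j ≤ n, (((a⁻¹ * s) ^ j) (α z : X)) = ((α ^ (j + 1)) z : X) := by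
    intro j hj
    induction j with
    | zero => simp
    | succ j ih =>
      have hnot := hmin (j + 1) (by omega) (by omega)
      rw [pow_succ', mul_apply (a⁻¹ * s), ih (by omega), pow_succ' α (j + 1), mul_apply α]
      refine (hα.apply_eq _ ?_).symm
      by_contra hcon
      exact hnot ((hW _).2 hcon)
  obtain ⟨k, hk, hkz, hkmin⟩ := hα z
  obtain ⟨k, rfl⟩ := Nat.exists_eq_add_of_le' hk
  have hkz' : (a ^ k) (α z : X) = (a⁻¹ * s) (z : X) := by
    rw [mul_apply, ← hkz, pow_succ', mul_apply, Perm.inv_def, symm_apply_apply]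
  have hk0 : 1 ≤ k := by
    by_contra hcon
    obtain rfl : k = 0 := by omega
    exact (hW _).1 hz (hkz' ▸ (α z).2)
  obtain ⟨k, rfl⟩ := Nat.exists_eq_add_of_le' hk0
  have haW : ∀ j ≤ k, (a ^ (j + 1)) (α z : X) ∈ W := fun j hj =>
    (hW _).2 (hkmin (j + 1) (by omega) (by omega))
  have hv : a (α z : X) ∈ W := by simpa using haW 0 (Nat.zero_le _)
  have hβpow : ∀ j ≤ k, ((β ^ j) ⟨_, hv⟩ : X) = (a ^ (j + 1)) (α z : X) := by
    intro j hj
    induction j with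
    | zero => simp
    | succ j ih =>
      have ih' := ih (by omega)
      rw [pow_succ', mul_apply, hβ.apply_eq, hba, ih', pow_succ' a (j + 1), mul_apply]
      rw [hba, ih', ← mul_apply, ← pow_succ']
      exact haW (j + 1) hj
  have hvw : (β ^ k) ⟨_, hv⟩ = ⟨_, hz⟩ := Subtype.ext (by rw [hβpow k le_rfl, hkz'])
  have hlast : β ⟨_, hz'⟩ = ⟨_, hv⟩ := by
    obtain ⟨m, hm, hmw, hmmin⟩ := hβ ⟨_, hz'⟩
    have hWs : ∀ x, x ∈ W ↔ s x ∈ W := fun x => by rw [hW, hW, ← hZ]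
    generalize hu : s (β ⟨_, hz'⟩ : X) = u
    have huW : u ∈ W := hu ▸ (hWs _).1 (β _).2
    have hmin' : ∀ j, 1 ≤ j → j < m → ((a⁻¹ * s) ^ j) u ∈ Z := by
      intro j hj hjm
      have := hmmin j hj hjm
      rw [hbφ, mul_mul_pow_apply_of_involutive hs, hu, ← hWs, hW, not_not] at this
      exact this
    have hend : ((a⁻¹ * s) ^ m) u = ((a⁻¹ * s) ^ (n + 1)) (α z : X) := by
      rw [hbφ, mul_mul_pow_apply_of_involutive hs, hu] at hmw
      exact (s.injective hmw).trans (by rw [pow_succ' (a⁻¹ * s) n, mul_apply _ (_ ^ n), hpow n le_rfl])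
    have hsv : ((a⁻¹ * s)) (s (a (α z : X))) = (α z : X) := by simp [hs]
    have hend' : ((a⁻¹ * s) ^ m) u = ((a⁻¹ * s) ^ (n + 2)) (s (a (α z : X))) := by
      rw [hend, pow_succ _ (n + 1), mul_apply, hsv]
    have hm2 : m = n + 2 := by
      rcases lt_trichotomy m (n + 2) with hlt | heq | hgt
      · exfalso
        obtain ⟨i, hi⟩ := Nat.exists_eq_add_of_le (show m ≤ n + 1 by omega)
        rw [hi, pow_add, mul_apply] at hend
        have := ((a⁻¹ * s) ^ m).injective hend
        rw [hpow i (by omega)] at this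
        exact (hW _).1 huW (this ▸ Subtype.coe_prop _)
      · exact heq
      · exfalso
        obtain ⟨i, hi⟩ := Nat.exists_eq_add_of_lt hgt
        rw [show m = (n + 2) + (i + 1) by omega, pow_add, mul_apply] at hend'
        have h1 := ((a⁻¹ * s) ^ (n + 2)).injective hend'
        have h2 := hmin' (i + 1) (by omega) (by omega)
        rw [h1] at h2
        exact (hW _).1 ((hWs _).1 hv) h2
    subst hm2
    have h1 := ((a⁻¹ * s) ^ (n + 2)).injective hend'
    exact Subtype.ext (s.injective (hu.trans h1))
  have h1 : β.SameCycle ⟨_, hz'⟩ ⟨_, hz⟩ := by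
    refine ⟨(k + 1 : ℕ), ?_⟩
    rw [zpow_natCast, pow_succ, mul_apply, hlast, hvw]
  exact h1.symm

lemma sameCycle_of_isBackwardReturn [Finite X] (hs : ∀ x, s (s x) = x)
    (hZ : ∀ x, x ∈ Z ↔ s x ∈ Z) (hW : ∀ x, x ∈ W ↔ x ∉ Z) (hb : b = s * a⁻¹)
    (hα : IsBackwardReturn s a Z α) (hβ : IsBackwardReturn s b W β)
    {z z' : Z} (hz : (a⁻¹ * s) (z : X) ∈ W) (hz' : (a⁻¹ * s) (z' : X) ∈ W)
    (h : α.SameCycle z z') : β.SameCycle ⟨_, hz⟩ ⟨_, hz'⟩ := by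
  refine SameCycle.of_first_return (E := {z : Z | (a⁻¹ * s) (z : X) ∈ W})
    (r := fun x y => ∀ hx : (a⁻¹ * s) (x : X) ∈ W, ∃ hy : (a⁻¹ * s) (y : X) ∈ W,
      β.SameCycle ⟨_, hx⟩ ⟨_, hy⟩) (fun x hx => ⟨hx, SameCycle.refl _ _⟩) ?_ ?_ h hz hz' hz |>.2
  · intro x y z hxy hyz hx
    obtain ⟨hy, h1⟩ := hxy hx
    obtain ⟨hz, h2⟩ := hyz hy
    exact ⟨hz, h1.trans h2⟩
  · intro x _ n hn hmin hx
    exact ⟨hn, sameCycle_of_isBackwardReturn_of_first_exit hs hZ hW hb hα hβ x hx n hn hmin⟩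

lemma sameCycle_iff_of_isBackwardReturn [Finite X] (hs : ∀ x, s (s x) = x)
    (hZ : ∀ x, x ∈ Z ↔ s x ∈ Z) (hW : ∀ x, x ∈ W ↔ x ∉ Z) (hb : b = s * a⁻¹)
    (hα : IsBackwardReturn s a Z α) (hβ : IsBackwardReturn s b W β)
    {t : Perm Z} (ht : ∀ z : Z, (t z : X) = s z)
    {z z' : Z} (hz : (a⁻¹ * s) (z : X) ∈ W) (hz' : (a⁻¹ * s) (z' : X) ∈ W) :
    α.SameCycle z z' ↔ β.SameCycle ⟨_, hz⟩ ⟨_, hz'⟩ := by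
  refine ⟨sameCycle_of_isBackwardReturn hs hZ hW hb hα hβ hz hz', fun h => ?_⟩
  have hba : ∀ x, (b⁻¹ * s) ((a⁻¹ * s) x) = s x := fun x => by
    rw [mul_apply, inv_eq_iff_eq]; simp [hb]
  have hsinv : s⁻¹ = s := by
    ext x
    rw [inv_eq_iff_eq, hs]
  have htt : t⁻¹ = t := by
    ext z
    rw [inv_eq_iff_eq.2]
    exact Subtype.ext (by rw [ht, ht, hs])
  have key := sameCycle_of_isBackwardReturn (a := b) (b := s * a * s) (Z := W) (W := Z) hs
    (fun x => by rw [hW, hW, ← hZ]) (fun x => by rw [hW, not_not])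
    (by rw [hb, mul_inv_rev, inv_inv, hsinv, mul_assoc]) hβ (hα.conj hs hZ ht)
    (z := ⟨_, hz⟩) (z' := ⟨_, hz'⟩)
    (by rw [hba]; exact (hZ _).1 z.2) (by rw [hba]; exact (hZ _).1 z'.2) h
  have e : ∀ (y : Z) (h : (b⁻¹ * s) ((a⁻¹ * s) (y : X)) ∈ Z), (⟨_, h⟩ : Z) = t y :=
    fun y h => Subtype.ext (by rw [ht]; exact hba _)
  rw [e, e] at key
  have key' : (t * α * t⁻¹).SameCycle (t z) (t z') := by rwa [htt]
  rw [sameCycle_conj] at key'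
  simpa using key'

end

/-- If `τ` agrees with `σ` wherever `σ` stays in `Z`, then a cycle of `τ` fails to be a cycle of
`σ` iff `σ` maps one of its points outside `Z`. -/
lemma not_exists_image_eq_sameCycle_iff {X : Type*} [Finite X] {σ : Perm X} {Z : Set X}
    {τ : Perm Z} (h : ∀ z : Z, σ z ∈ Z → (τ z : X) = σ z)
    (C : Quotient (sameCycleSetoid τ)) :
    (¬ ∃ x : X, Subtype.val '' {w : Z | Quotient.mk (sameCycleSetoid τ) w = C} =
        {y : X | σ.SameCycle x y}) ↔
      ∃ z : Z, σ z ∉ Z ∧ Quotient.mk (sameCycleSetoid τ) z = C := by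
  rw [not_iff_comm]
  push Not
  constructor
  · intro hC
    obtain ⟨z, rfl⟩ := Quotient.exists_rep C
    have hmem : ∀ w : Z, τ.SameCycle z w → σ w ∈ Z := fun w hw => by
      by_contra hcon
      exact hC w hcon (Quotient.sound (s := sameCycleSetoid τ) hw.symm)
    have hpow : ∀ n : ℕ, (σ ^ n) (z : X) = ((τ ^ n) z : Z) := by
      intro n
      induction n with
      | zero => simp
      | succ n ih =>
        rw [pow_succ', mul_apply, ih, pow_succ' τ, mul_apply, h]
        exact hmem _ ⟨n, by simp⟩
    refine ⟨z, Set.ext fun y => ⟨?_, ?_⟩⟩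
    · rintro ⟨w, hw, rfl⟩
      have hw' : τ.SameCycle z w := SameCycle.symm (Quotient.exact hw)
      obtain ⟨n, -, -, rfl⟩ := hw'.exists_pow_eq''
      exact ⟨n, by rw [zpow_natCast, hpow]⟩
    · intro hy
      obtain ⟨n, -, -, rfl⟩ := SameCycle.exists_pow_eq'' (Set.mem_ofPred.1 hy)
      refine ⟨(τ ^ n) z, ?_, (hpow n).symm⟩
      exact Quotient.sound (s := sameCycleSetoid τ) (SameCycle.symm ⟨n, by simp⟩)
  · rintro ⟨x, hx⟩ z hz rfl
    have h1 : (z : X) ∈ {y : X | σ.SameCycle x y} := hx ▸ ⟨z, rfl, rfl⟩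
    have h2 : σ z ∈ {y : X | σ.SameCycle x y} := sameCycle_apply_right.2 h1
    rw [← hx] at h2
    obtain ⟨w, -, hw⟩ := h2
    exact hz (hw ▸ w.2)

/-- Two families of classes indexed by `ι` are equinumerous if the indexing maps
identify the same indices. -/
lemma nonempty_equiv_of_forall_quotient_eq_iff {ι A B : Type*} {S : Setoid A} {T : Setoid B}
    {p : Quotient S → Prop} {q : Quotient T → Prop} (f : ι → A) (g : ι → B)
    (hp : ∀ C, p C ↔ ∃ i, Quotient.mk S (f i) = C) (hq : ∀ D, q D ↔ ∃ i, Quotient.mk T (g i) = D)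
    (hfg : ∀ i j, Quotient.mk S (f i) = Quotient.mk S (f j) ↔
      Quotient.mk T (g i) = Quotient.mk T (g j)) :
    Nonempty ({C // p C} ≃ {D // q D}) := by
  choose u hu using fun C : {C // p C} => (hp C).1 C.2
  refine ⟨Equiv.ofBijective (fun C => ⟨Quotient.mk T (g (u C)), (hq _).2 ⟨_, rfl⟩⟩) ⟨?_, ?_⟩⟩
  · intro C D hCD
    have := (hfg _ _).2 (congrArg Subtype.val hCD)
    exact Subtype.ext (by rw [← hu C, ← hu D, this])
  · rintro ⟨D, hD⟩
    obtain ⟨i, rfl⟩ := (hq D).1 hD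
    exact ⟨⟨_, (hp _).2 ⟨i, rfl⟩⟩, Subtype.ext ((hfg _ _).1 (hu _))⟩


/-- **Exceptional holes of the subgraph correspond to exceptional vertices of the
quotient graph.**  Let `(X, σ₀, σ₁)` be a ribbon graph with hole permutation
`σ∞ := σ₀⁻¹ ∘ σ₁`, and let `Z ⊆ X` be a nonempty proper `σ₁`-invariant subset.
Let `α₀` be the first-return map of `σ₀` to `Z` (the vertex permutation of the
subgraph `G_Z`) and `α∞ := α₀⁻¹ ∘ (σ₁|_Z)` its hole permutation; let `β∞` be the
first-return map of `σ∞` to `X∖Z` (the hole permutation of the quotient graph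
`G/G_Z`) and `β₀ := (σ₁|_{X∖Z}) ∘ β∞⁻¹` its vertex permutation.  Then there is a
bijection between the orbits of `α∞` on `Z` that are not orbits of `σ∞` (the
exceptional holes of `G_Z`) and the orbits of `β₀` on `X∖Z` that are not orbits of
`σ₀` (the exceptional vertices of `G/G_Z`). -/
theorem exceptional_holes_equiv_exceptional_vertices {X : Type*} [Fintype X]
    (σ₀ σ₁ : Equiv.Perm X) (hinv : σ₁ * σ₁ = 1) (hfpf : ∀ x : X, σ₁ x ≠ x)
    (Z : Set X) (hZne : Z.Nonempty) (hZproper : Z ≠ Set.univ)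
    (hZinv : ∀ x : X, x ∈ Z ↔ σ₁ x ∈ Z)
    (σ₁Z : Equiv.Perm Z) (hσ₁Z : ∀ z : Z, ((σ₁Z z : Z) : X) = σ₁ (z : X))
    (σ₁Zc : Equiv.Perm ↥(Zᶜ)) (hσ₁Zc : ∀ z : ↥(Zᶜ), ((σ₁Zc z : ↥(Zᶜ)) : X) = σ₁ (z : X))
    (α₀ : Equiv.Perm Z) (hα₀ : IsFirstReturn σ₀ Z α₀)
    (βinf : Equiv.Perm ↥(Zᶜ)) (hβinf : IsFirstReturn (σ₀⁻¹ * σ₁) (Zᶜ) βinf) :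
    Nonempty (
      {C : Quotient (sameCycleSetoid (α₀⁻¹ * σ₁Z)) //
        ¬ ∃ x : X, Subtype.val ''
            {w : Z | Quotient.mk (sameCycleSetoid (α₀⁻¹ * σ₁Z)) w = C}
          = {y : X | (σ₀⁻¹ * σ₁).SameCycle x y}} ≃
      {C : Quotient (sameCycleSetoid (σ₁Zc * βinf⁻¹)) //
        ¬ ∃ x : X, Subtype.val ''
            {w : ↥(Zᶜ) | Quotient.mk (sameCycleSetoid (σ₁Zc * βinf⁻¹)) w = C}
          = {y : X | σ₀.SameCycle x y}}) := by
  have hs : ∀ x, σ₁ (σ₁ x) = x := fun x => by rw [← Perm.mul_apply, hinv, Perm.one_apply]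
  have hW : ∀ x, x ∈ Zᶜ ↔ x ∉ Z := fun x => Iff.rfl
  have hα : IsBackwardReturn σ₁ σ₀ Z (α₀⁻¹ * σ₁Z) := by
    intro z
    obtain ⟨k, hk, hkz, hmin⟩ := hα₀ ((α₀⁻¹ * σ₁Z) z)
    refine ⟨k, hk, ?_, fun j hj hjk hmem => absurd (hmin j hj hmem) (not_le.2 hjk)⟩
    rw [hkz, Perm.mul_apply, Perm.inv_def, Equiv.apply_symm_apply, hσ₁Z]
  have hconj : σ₁ * σ₀⁻¹ = σ₁ * (σ₀⁻¹ * σ₁) * σ₁ := by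
    ext x; simp [hs]
  have hβ : IsBackwardReturn σ₁ (σ₁ * σ₀⁻¹) Zᶜ (σ₁Zc * βinf⁻¹) := by
    intro w
    obtain ⟨k, hk, hkw, hmin⟩ := hβinf (βinf⁻¹ w)
    refine ⟨k, hk, ?_, fun j hj hjk hmem => absurd (hmin j hj ?_) (not_le.2 hjk)⟩
    · rw [hconj, mul_mul_pow_apply_of_involutive hs, Perm.mul_apply, hσ₁Zc, hs, hkw,
        Perm.inv_def, Equiv.apply_symm_apply]
    · rw [hconj, mul_mul_pow_apply_of_involutive hs, Perm.mul_apply, hσ₁Zc, hs] at hmem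
      exact fun hmem' => hmem ((hZinv _).1 hmem')
  have hba : (σ₁ * σ₀⁻¹)⁻¹ * σ₁ = σ₀ := by group
  refine nonempty_equiv_of_forall_quotient_eq_iff
    (ι := {z : Z // (σ₀⁻¹ * σ₁) (z : X) ∈ Zᶜ}) (fun z => z.1) (fun z => ⟨_, z.2⟩) ?_ ?_ ?_
  · intro C
    rw [not_exists_image_eq_sameCycle_iff hα.apply_eq]
    exact ⟨fun ⟨z, hz, h⟩ => ⟨⟨z, hz⟩, h⟩, fun ⟨z, h⟩ => ⟨z.1, z.2, h⟩⟩
  · intro D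
    rw [not_exists_image_eq_sameCycle_iff (fun w hw => by
      have := hβ.apply_eq w
      rw [hba] at this
      exact this hw)]
    constructor
    · rintro ⟨w, hw, rfl⟩
      have hz : σ₁ (σ₀ (w : X)) ∈ Z := (hZinv _).1 (not_not.1 hw)
      have hzw : (σ₀⁻¹ * σ₁) (σ₁ (σ₀ (w : X))) = w := by simp [hs]
      refine ⟨⟨⟨_, hz⟩, by rw [hzw]; exact w.2⟩, ?_⟩
      exact congrArg _ (Subtype.ext hzw)
    · rintro ⟨z, rfl⟩
      refine ⟨_, ?_, rfl⟩
      simpa using (hZinv _).1 z.1.2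
  · intro z z'
    have key := sameCycle_iff_of_isBackwardReturn hs hZinv hW rfl hα hβ hσ₁Z z.2 z'.2
    exact ⟨fun h => Quotient.sound (s := sameCycleSetoid _) (key.1 (Quotient.exact h)),
      fun h => Quotient.sound (s := sameCycleSetoid _) (key.2 (Quotient.exact h))⟩
end
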